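/- Let p, q ∈ ℝ[z] have degrees d with distinct roots, and let p_ℝ, q_ℝ be the numbers of real roots and p_ℂ, q_ℂ the numbers of pairs of complex conjugate roots of p and q. Then the dimension of the ι-invariant Birkhoff polytope B_d^ι equals (p_ℝ + p_ℂ)(q_ℝ + q_ℂ) − (p_ℝ + p_ℂ + q_ℝ + q_ℂ − 1) + p_ℂ q_ℂ. -/

import Mathlib

/-- The `ι`-invariant Birkhoff polytope for the involution `(ιM)_{ij} = M_{φ(i)ψ(j)}`. -/
def invBirkhoff (d : ℕ) (φ ψ : Equiv.Perm (Fin d)) : Set (Matrix (Fin d) (Fin d) ℝ) :=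
  {M | M ∈ doublyStochastic ℝ (Fin d) ∧ (fun i j => M (φ i) (ψ j)) = M}

open Matrix

/-- The space of matrices with zero row and column sums fixed by `M ↦ M.submatrix φ ψ`. -/
def invZeroSum {n : Type*} [Fintype n] (φ ψ : Equiv.Perm n) : Submodule ℝ (Matrix n n ℝ) where
  carrier := {M | (∀ i, ∑ j, M i j = 0) ∧ (∀ j, ∑ i, M i j = 0) ∧ ∀ i j, M (φ i) (ψ j) = M i j}
  add_mem' := by
    rintro M N ⟨h1, h2, h3⟩ ⟨k1, k2, k3⟩
    simp [Finset.sum_add_distrib, *]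
  zero_mem' := by simp
  smul_mem' := by
    rintro c M ⟨h1, h2, h3⟩
    simp [← Finset.mul_sum, *]

theorem mem_invZeroSum {n : Type*} [Fintype n] {φ ψ : Equiv.Perm n} {M : Matrix n n ℝ} :
    M ∈ invZeroSum φ ψ ↔ (∀ i, ∑ j, M i j = 0) ∧ (∀ j, ∑ i, M i j = 0) ∧
      ∀ i j, M (φ i) (ψ j) = M i j := Iff.rfl

/-- The linear map `M ↦ A * M * Bᵀ`. -/
def mulMulTranspose {n : Type*} [Fintype n] (A B : Matrix n n ℝ) :
    Matrix n n ℝ →ₗ[ℝ] Matrix n n ℝ where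
  toFun M := A * M * Bᵀ
  map_add' M N := by rw [Matrix.mul_add, Matrix.add_mul]
  map_smul' c M := by simp

theorem mulMulTranspose_apply_eq_sum {n : Type*} [Fintype n] (A B M : Matrix n n ℝ) (i j : n) :
    mulMulTranspose A B M i j = ∑ l, ∑ k, A i k * M k l * B j l := by
  simp [mulMulTranspose, Matrix.mul_apply, Finset.sum_mul]

theorem trace_mulMulTranspose {n : Type*} [Fintype n] [DecidableEq n] (A B : Matrix n n ℝ) :
    LinearMap.trace ℝ _ (mulMulTranspose A B) = A.trace * B.trace := by
  rw [LinearMap.trace_eq_matrix_trace ℝ (Matrix.stdBasis ℝ n n), Matrix.trace,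
    Fintype.sum_prod_type, Matrix.trace, Matrix.trace, Finset.sum_mul_sum]
  refine Finset.sum_congr rfl fun i _ => Finset.sum_congr rfl fun j _ => ?_
  rw [Matrix.diag_apply, LinearMap.toMatrix_apply, Matrix.stdBasis_eq_single]
  simp [mulMulTranspose, Matrix.stdBasis, Matrix.mul_apply, Matrix.single_apply, ite_and]

/-- The permutation matrix of `φ` followed by projection to the zero-sum vectors. -/
noncomputable def centeredPerm {n : Type*} [Fintype n] [DecidableEq n] (φ : Equiv.Perm n) :
    Matrix n n ℝ :=
  Matrix.of fun i k => (if φ i = k then 1 else 0) - (Fintype.card n : ℝ)⁻¹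

section

variable {n : Type*} [Fintype n] [DecidableEq n]

theorem trace_centeredPerm [Nonempty n] (φ : Equiv.Perm n) :
    (centeredPerm φ).trace = Fintype.card {i // φ i = i} - 1 := by
  simp [centeredPerm, Matrix.trace, Fintype.card_subtype]

theorem centeredPerm_apply_perm (φ σ : Equiv.Perm n) (i k : n) :
    centeredPerm φ (σ i) k = centeredPerm (φ * σ) i k :=
  rfl

theorem sum_centeredPerm [Nonempty n] (φ : Equiv.Perm n) (k : n) :
    ∑ i, centeredPerm φ i k = 0 := by
  have h (i : n) : φ i = k ↔ i = φ.symm k := φ.eq_symm_apply.symm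
  simp [centeredPerm, h]

theorem sum_row_mulMulTranspose_centeredPerm [Nonempty n] (A M : Matrix n n ℝ)
    (ψ : Equiv.Perm n) (i : n) : ∑ j, mulMulTranspose A (centeredPerm ψ) M i j = 0 := by
  simp only [mulMulTranspose_apply_eq_sum]
  rw [Finset.sum_comm]
  refine Finset.sum_eq_zero fun l _ => ?_
  rw [Finset.sum_comm]
  simp [← Finset.mul_sum, sum_centeredPerm]

theorem sum_col_mulMulTranspose_centeredPerm [Nonempty n] (B M : Matrix n n ℝ)
    (φ : Equiv.Perm n) (j : n) : ∑ i, mulMulTranspose (centeredPerm φ) B M i j = 0 := by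
  simp only [mulMulTranspose_apply_eq_sum]
  rw [Finset.sum_comm]
  refine Finset.sum_eq_zero fun l _ => ?_
  rw [Finset.sum_comm]
  simp [← Finset.sum_mul, sum_centeredPerm]

theorem mulMulTranspose_centeredPerm_perm (φ ψ σ τ : Equiv.Perm n) (M : Matrix n n ℝ) (i j : n) :
    mulMulTranspose (centeredPerm φ) (centeredPerm ψ) M (σ i) (τ j) =
      mulMulTranspose (centeredPerm (φ * σ)) (centeredPerm (ψ * τ)) M i j := by
  simp only [mulMulTranspose_apply_eq_sum, centeredPerm_apply_perm]

theorem mulMulTranspose_centeredPerm_of_sum_eq_zero (φ ψ : Equiv.Perm n) {M : Matrix n n ℝ}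
    (hr : ∀ i, ∑ j, M i j = 0) (hc : ∀ j, ∑ i, M i j = 0) (i j : n) :
    mulMulTranspose (centeredPerm φ) (centeredPerm ψ) M i j = M (φ i) (ψ j) := by
  simp [mulMulTranspose_apply_eq_sum, centeredPerm, ← Finset.sum_mul, sub_mul, mul_sub,
    Finset.sum_sub_distrib, ← Finset.mul_sum, hr, hc]

theorem isProj_invZeroSum [Nonempty n] {φ ψ : Equiv.Perm n} (hφ : φ * φ = 1) (hψ : ψ * ψ = 1) :
    LinearMap.IsProj (invZeroSum φ ψ)
      ((2⁻¹ : ℝ) • (mulMulTranspose (centeredPerm 1) (centeredPerm 1) +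
        mulMulTranspose (centeredPerm φ) (centeredPerm ψ))) where
  map_mem M := by
    refine Submodule.smul_mem _ _ (mem_invZeroSum.2 ⟨fun i => ?_, fun j => ?_, fun i j => ?_⟩)
    · simp [Finset.sum_add_distrib, sum_row_mulMulTranspose_centeredPerm]
    · simp [Finset.sum_add_distrib, sum_col_mulMulTranspose_centeredPerm]
    · simp [mulMulTranspose_centeredPerm_perm, hφ, hψ, add_comm]
  map_id M hM := by
    obtain ⟨hr, hc, h⟩ := mem_invZeroSum.1 hM
    ext i j
    simp only [LinearMap.smul_apply, LinearMap.add_apply, Matrix.smul_apply, Matrix.add_apply,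
      mulMulTranspose_centeredPerm_of_sum_eq_zero _ _ hr hc, h, Equiv.Perm.one_apply, smul_eq_mul]
    ring

theorem finrank_invZeroSum [Nonempty n] {φ ψ : Equiv.Perm n} (hφ : φ * φ = 1) (hψ : ψ * ψ = 1) :
    (Module.finrank ℝ (invZeroSum φ ψ) : ℝ) =
      2⁻¹ * (((Fintype.card n : ℝ) - 1) * (Fintype.card n - 1) +
        (Fintype.card {i // φ i = i} - 1) * (Fintype.card {j // ψ j = j} - 1)) := by
  rw [← (isProj_invZeroSum hφ hψ).trace]
  simp [trace_mulMulTranspose, trace_centeredPerm, mul_add]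

end

theorem mem_invBirkhoff {d : ℕ} {φ ψ : Equiv.Perm (Fin d)} {M : Matrix (Fin d) (Fin d) ℝ} :
    M ∈ invBirkhoff d φ ψ ↔ ((∀ i j, 0 ≤ M i j) ∧ (∀ i, ∑ j, M i j = 1) ∧
      ∀ j, ∑ i, M i j = 1) ∧ ∀ i j, M (φ i) (ψ j) = M i j := by
  rw [← mem_doublyStochastic_iff_sum]
  exact and_congr_right fun _ => Matrix.ext_iff.symm

theorem direction_affineSpan_invBirkhoff {d : ℕ} (hd : 0 < d) (φ ψ : Equiv.Perm (Fin d)) :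
    (affineSpan ℝ (invBirkhoff d φ ψ)).direction = invZeroSum φ ψ := by
  rw [direction_affineSpan]
  have hd' : (0 : ℝ) < d := Nat.cast_pos.2 hd
  apply le_antisymm
  · rw [vectorSpan_def, Submodule.span_le]
    rintro _ ⟨M, hM, N, hN, rfl⟩
    obtain ⟨⟨-, hMr, hMc⟩, hMi⟩ := mem_invBirkhoff.1 hM
    obtain ⟨⟨-, hNr, hNc⟩, hNi⟩ := mem_invBirkhoff.1 hN
    exact mem_invZeroSum.2 (by simp [*])
  · intro M hM
    obtain ⟨hr, hc, hi⟩ := mem_invZeroSum.1 hM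
    have habs (i j : Fin d) : |M i j| ≤ ∑ k, ∑ l, |M k l| :=
      (Finset.single_le_sum (f := fun l => |M i l|) (fun _ _ => abs_nonneg _)
        (Finset.mem_univ j)).trans
      (Finset.single_le_sum (f := fun k => ∑ l, |M k l|)
        (fun _ _ => Finset.sum_nonneg fun _ _ => abs_nonneg _) (Finset.mem_univ i))
    set s := ∑ k, ∑ l, |M k l|
    have hs : 0 ≤ s := Finset.sum_nonneg fun _ _ => Finset.sum_nonneg fun _ _ => abs_nonneg _
    have hε : 0 < (d : ℝ)⁻¹ * (1 + s)⁻¹ := by positivity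
    set J : Matrix (Fin d) (Fin d) ℝ := Matrix.of fun _ _ => (d : ℝ)⁻¹
    have hJ : J ∈ invBirkhoff d φ ψ := mem_invBirkhoff.2 (by simp [J, hd'.ne'])
    have hJM : ((d : ℝ)⁻¹ * (1 + s)⁻¹) • M + J ∈ invBirkhoff d φ ψ := by
      refine mem_invBirkhoff.2 ⟨⟨fun i j => ?_, fun i => ?_, fun j => ?_⟩, fun i j => ?_⟩
      · have h : -1 ≤ (1 + s)⁻¹ * M i j := by
          rw [inv_mul_eq_div, le_div_iff₀ (by positivity)]
          linarith [neg_abs_le (M i j), habs i j]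
        have := mul_le_mul_of_nonneg_left h (inv_nonneg.2 hd'.le)
        simp only [J, Matrix.add_apply, Matrix.smul_apply, Matrix.of_apply, smul_eq_mul]
        linarith
      · simp [J, Finset.sum_add_distrib, ← Finset.mul_sum, hr, hd'.ne']
      · simp [J, Finset.sum_add_distrib, ← Finset.mul_sum, hc, hd'.ne']
      · simp [J, hi]
    have h := vsub_mem_vectorSpan ℝ hJM hJ
    rw [vsub_eq_sub, add_sub_cancel_right] at h
    exact (Submodule.smul_mem_iff _ hε.ne').1 h

theorem perm_mul_self_of_conj {n : Type*} {α : n → ℂ} (hα : Function.Injective α)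
    {φ : Equiv.Perm n} (hφ : ∀ i, (starRingEnd ℂ) (α i) = α (φ i)) : φ * φ = 1 := by
  ext i : 1
  exact hα (by simp [← hφ])

theorem perm_apply_eq_self_iff_im_eq_zero {n : Type*} {α : n → ℂ} (hα : Function.Injective α)
    {φ : Equiv.Perm n} (hφ : ∀ i, (starRingEnd ℂ) (α i) = α (φ i)) (i : n) :
    φ i = i ↔ (α i).im = 0 := by
  rw [← hα.eq_iff, ← hφ, Complex.conj_eq_iff_im]

/-- Dimension formula for the invariant Birkhoff polytope: if `p, q` have `pR, qR`
real roots and `pC, qC` pairs of complex conjugate roots, then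
`dim B_d^ι = (pR+pC)(qR+qC) − (pR+pC+qR+qC−1) + pC·qC`. -/
theorem stmt_9 (d pR pC qR qC : ℕ) (hd : 0 < d) (α β : Fin d → ℂ)
    (hα : Function.Injective α) (hβ : Function.Injective β)
    (φ ψ : Equiv.Perm (Fin d))
    (hφ : ∀ i, (starRingEnd ℂ) (α i) = α (φ i))
    (hψ : ∀ j, (starRingEnd ℂ) (β j) = β (ψ j))
    (hpR : pR = Fintype.card {i : Fin d // (α i).im = 0})
    (hqR : qR = Fintype.card {j : Fin d // (β j).im = 0})
    (hpC : d = pR + 2 * pC) (hqC : d = qR + 2 * qC) :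
    (Module.finrank ℝ (affineSpan ℝ (invBirkhoff d φ ψ)).direction : ℤ) =
      ((pR : ℤ) + pC) * ((qR : ℤ) + qC)
        - ((pR : ℤ) + pC + qR + qC - 1) + (pC : ℤ) * qC := by
  have : Nonempty (Fin d) := ⟨⟨0, hd⟩⟩
  have h := finrank_invZeroSum (perm_mul_self_of_conj hα hφ) (perm_mul_self_of_conj hβ hψ)
  simp only [perm_apply_eq_self_iff_im_eq_zero hα hφ, perm_apply_eq_self_iff_im_eq_zero hβ hψ,
    ← hpR, ← hqR, Fintype.card_fin] at h
  rw [direction_affineSpan_invBirkhoff hd]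
  have hp : (d : ℝ) = pR + 2 * pC := by exact_mod_cast hpC
  have hq : (d : ℝ) = qR + 2 * qC := by exact_mod_cast hqC
  have key : (Module.finrank ℝ (invZeroSum φ ψ) : ℝ) =
      ((pR : ℝ) + pC) * ((qR : ℝ) + qC)
        - ((pR : ℝ) + pC + qR + qC - 1) + (pC : ℝ) * qC := by
    rw [h]
    nth_rewrite 1 [hp]
    rw [hq]
    ring
  exact_mod_cast key
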